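/- Let ℂⁿ = H_S ⊕ H_C ⊕ H_Z be an orthogonal decomposition with orthogonal projections Π_S, Π_C, Π_Z. Let H ∈ M_n(ℂ) be Hermitian and L_1, …, L_r ∈ M_n(ℂ), with Lindblad generator 𝓛. Then for every matrix ρ ∈ M_n(ℂ) with Π_Z ρ Π_Z = ρ (ρ supported in H_Z), one has Π_C · 𝓛(ρ) · Π_C = Σ_k (Π_C L_k Π_Z) ρ (Π_C L_k Π_Z)†; moreover, if ρ is positive semidefinite then Π_C · 𝓛(ρ) · Π_C is positive semidefinite. -/

import Mathlib

open scoped Matrix ComplexOrder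

noncomputable section

attribute [local instance] Matrix.normedAddCommGroup Matrix.normedSpace

abbrev Mat (n : ℕ) := Matrix (Fin n) (Fin n) ℂ

/-- The Lindblad generator `𝓛(ρ) = −i[H,ρ] + Σ_k (L_k ρ L_k† − ½(L_k† L_k ρ + ρ L_k† L_k))`. -/
def lindblad {n r : ℕ} (H : Mat n) (L : Fin r → Mat n) : Mat n →ₗ[ℂ] Mat n :=
  (-Complex.I) • (LinearMap.mulLeft ℂ H - LinearMap.mulRight ℂ H)
    + ∑ k, ((LinearMap.mulRight ℂ (L k)ᴴ).comp (LinearMap.mulLeft ℂ (L k))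
        - (1/2 : ℂ) • (LinearMap.mulLeft ℂ ((L k)ᴴ * L k)
            + LinearMap.mulRight ℂ ((L k)ᴴ * L k)))

/-- `evol H L t ρ = exp (t 𝓛) ρ`, the solution of the master equation at time `t`. -/
def evol {n r : ℕ} (H : Mat n) (L : Fin r → Mat n) (t : ℝ) (ρ : Mat n) : Mat n :=
  haveI : IsTopologicalRing (Mat n →L[ℂ] Mat n) :=
    inferInstanceAs (IsTopologicalRing ((Fin n → Fin n → ℂ) →L[ℂ] (Fin n → Fin n → ℂ)))
  NormedSpace.exp ((t : ℂ) • (lindblad H L).toContinuousLinearMap) ρ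

theorem lindblad_apply {n r : ℕ} (H : Mat n) (L : Fin r → Mat n) (ρ : Mat n) :
    lindblad H L ρ = (-Complex.I) • (H * ρ - ρ * H)
      + ∑ k, (L k * ρ * (L k)ᴴ
          - (1/2 : ℂ) • ((L k)ᴴ * L k * ρ + ρ * ((L k)ᴴ * L k))) := by
  simp [lindblad, LinearMap.sum_apply, mul_assoc]

/-- Compressing the generator by a matrix `P` annihilating `ρ` on both sides leaves only the
jump terms. -/
theorem mul_lindblad_mul_of_mul_eq_zero {n r : ℕ} (H : Mat n) (L : Fin r → Mat n) {P ρ : Mat n}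
    (hl : P * ρ = 0) (hr : ρ * P = 0) :
    P * lindblad H L ρ * P = ∑ k, P * (L k * ρ * (L k)ᴴ) * P := by
  have left (X : Mat n) : P * (ρ * X) * P = 0 := by rw [← mul_assoc, hl, zero_mul, zero_mul]
  have right (X : Mat n) : P * (X * ρ) * P = 0 := by
    rw [mul_assoc, mul_assoc, hr, mul_zero, mul_zero]
  simp only [lindblad_apply, mul_add, add_mul, mul_sub, sub_mul, mul_smul_comm, smul_mul_assoc,
    Finset.mul_sum, Finset.sum_mul, left, right, sub_zero, add_zero, smul_zero, zero_add]

/-- For the orthogonal decomposition `ℂⁿ = H_S ⊕ H_C ⊕ H_Z` and any state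
`ρ` supported in `H_Z`, the `C`-block of the Lindblad generator is
`Π_C 𝓛(ρ) Π_C = Σ_k (Π_C L_k Π_Z) ρ (Π_C L_k Π_Z)†`, which is positive semidefinite
whenever `ρ` is. -/
theorem lindblad_C_block {n r : ℕ}
    (PS PC PZ : Mat n)
    (hSH : PS.IsHermitian) (hCH : PC.IsHermitian) (hZH : PZ.IsHermitian)
    (hSidem : PS * PS = PS) (hCidem : PC * PC = PC) (hZidem : PZ * PZ = PZ)
    (hSC : PS * PC = 0) (hSZ : PS * PZ = 0) (hCZ : PC * PZ = 0)
    (hsum : PS + PC + PZ = 1)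
    (H : Mat n) (hH : H.IsHermitian) (L : Fin r → Mat n) :
    ∀ ρ : Mat n, PZ * ρ * PZ = ρ →
      PC * lindblad H L ρ * PC = ∑ k, (PC * L k * PZ) * ρ * (PC * L k * PZ)ᴴ ∧
      (ρ.PosSemidef → (PC * lindblad H L ρ * PC).PosSemidef) := by
  intro ρ hρ
  have hZC : PZ * PC = 0 := by
    simpa [hCH.eq, hZH.eq] using congrArg Matrix.conjTranspose hCZ
  have hl : PC * ρ = 0 := by
    rw [← hρ, ← mul_assoc, ← mul_assoc, hCZ, zero_mul, zero_mul]
  have hr : ρ * PC = 0 := by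
    rw [← hρ, mul_assoc, hZC, mul_zero]
  have hblock : PC * lindblad H L ρ * PC =
      ∑ k, (PC * L k * PZ) * ρ * (PC * L k * PZ)ᴴ := by
    rw [mul_lindblad_mul_of_mul_eq_zero H L hl hr]
    refine Finset.sum_congr rfl fun k _ => ?_
    conv_lhs => rw [← hρ]
    simp only [Matrix.conjTranspose_mul, hCH.eq, hZH.eq, mul_assoc]
  refine ⟨hblock, fun hpos => ?_⟩
  rw [hblock]
  exact Matrix.posSemidef_sum _ fun k _ => hpos.mul_mul_conjTranspose_same _
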